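/- Let Y be a complete doubling metric space, Z a complete separable metric space, and π : Y → Z a Lipschitz map. Let μ be a Borel probability measure on Y, let ν = π_*μ be its push-forward, and let (μ_z)_{z∈Z} be a disintegration of μ over ν along π. Assume there exist a constant γ ≥ 0 and a Borel map δ : Z → [0,∞) such that for μ-almost every y ∈ Y: (i) the lower pointwise dimension of μ_{π(y)} at y is ≥ γ, and (ii) the lower pointwise dimension of ν at π(y) is ≥ δ(π(y)). Then for μ-almost every y ∈ Y, the upper pointwise dimension of μ at y is ≥ γ + δ(π(y)). -/

import Mathlib

open MeasureTheory Filter Topology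

/-- The lower pointwise dimension of a measure `m` at a point `w`:
`liminf_{ρ → 0⁺} log m(B(w,ρ)) / log ρ`, where `B(w,ρ)` is the closed ball. -/
noncomputable def lowerPointwiseDim {W : Type*} [MetricSpace W] [MeasurableSpace W]
    (m : Measure W) (w : W) : ℝ :=
  liminf (fun ρ : ℝ => Real.log (m (Metric.closedBall w ρ)).toReal / Real.log ρ)
    (𝓝[>] (0 : ℝ))

/-- The upper pointwise dimension of a measure `m` at a point `w`:
`limsup_{ρ → 0⁺} log m(B(w,ρ)) / log ρ`, where `B(w,ρ)` is the closed ball. -/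
noncomputable def upperPointwiseDim {W : Type*} [MetricSpace W] [MeasurableSpace W]
    (m : Measure W) (w : W) : ℝ :=
  limsup (fun ρ : ℝ => Real.log (m (Metric.closedBall w ρ)).toReal / Real.log ρ)
    (𝓝[>] (0 : ℝ))

theorem aux_cover {Y : Type*} [MetricSpace Y] {N : ℕ}
    (hN : ∀ (y : Y) (r : ℝ), ∃ s : Finset Y,
      s.card ≤ N ∧ Metric.closedBall y r ⊆ ⋃ z ∈ s, Metric.closedBall z (r / 2)) (k : ℕ) :
    ∀ (y : Y) (r : ℝ), ∃ s : Finset Y,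
      s.card ≤ N ^ k ∧ Metric.closedBall y r ⊆ ⋃ z ∈ s, Metric.closedBall z (r / 2 ^ k) := by
  classical
  induction k with
  | zero => intro y r; exact ⟨{y}, by simp, by simp⟩
  | succ k ih =>
    intro y r
    obtain ⟨s, hs, hc⟩ := ih y r
    choose t ht htc using fun z => hN z (r / 2 ^ k)
    refine ⟨s.biUnion t, ?_, ?_⟩
    · calc _ ≤ s.card * N := Finset.card_biUnion_le_card_mul _ _ _ (fun z _ => ht z)
        _ ≤ N ^ k * N := Nat.mul_le_mul_right _ hs
        _ = _ := (pow_succ _ _).symm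
    · intro x hx
      obtain ⟨z, hz, hxz⟩ := Set.mem_iUnion₂.1 (hc hx)
      obtain ⟨w, hw, hxw⟩ := Set.mem_iUnion₂.1 (htc z hxz)
      refine Set.mem_iUnion₂.2 ⟨w, Finset.mem_biUnion.2 ⟨z, hz, hw⟩, ?_⟩
      rwa [pow_succ, ← div_div]

theorem aux_secondCountable {Y : Type*} [MetricSpace Y] {N : ℕ}
    (hN : ∀ (y : Y) (r : ℝ), ∃ s : Finset Y,
      s.card ≤ N ∧ Metric.closedBall y r ⊆ ⋃ z ∈ s, Metric.closedBall z (r / 2)) :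
    SecondCountableTopology Y := by
  rcases isEmpty_or_nonempty Y with h | ⟨⟨y0⟩⟩
  · infer_instance
  apply Metric.secondCountable_of_almost_dense_set
  intro ε hε
  choose s hs hc using fun (m k : ℕ) => aux_cover hN k y0 (m : ℝ)
  refine ⟨⋃ m, ⋃ k, (s m k : Set Y), ?_, ?_⟩
  · exact Set.countable_iUnion fun m => Set.countable_iUnion fun k => (s m k).countable_toSet
  · intro x
    obtain ⟨m, hm⟩ := exists_nat_ge (dist x y0)
    obtain ⟨k, hk⟩ := pow_unbounded_of_one_lt ((m : ℝ) / ε) (one_lt_two (α := ℝ))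
    obtain ⟨z, hz, hxz⟩ := Set.mem_iUnion₂.1 (hc m k (Metric.mem_closedBall.2 hm))
    refine ⟨z, Set.mem_iUnion₂.2 ⟨m, k, hz⟩, (Metric.mem_closedBall.1 hxz).trans ?_⟩
    rw [div_le_iff₀ (by positivity)]
    rw [div_lt_iff₀ hε] at hk
    linarith

theorem aux_mult {Y : Type*} [MetricSpace Y] {N : ℕ}
    (hN : ∀ (y : Y) (r : ℝ), ∃ s : Finset Y,
      s.card ≤ N ∧ Metric.closedBall y r ⊆ ⋃ z ∈ s, Metric.closedBall z (r / 2))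
    {r : ℝ} (hr : 0 < r) (x : Y) (T : Set Y) (hT : T ⊆ Metric.closedBall x r)
    (hsep : T.Pairwise fun a b => r < dist a b) : T.encard ≤ ((N ^ 2 : ℕ) : ℕ∞) := by
  obtain ⟨s, hs, hc⟩ := aux_cover hN 2 x r
  have : ∀ y ∈ T, ∃ z ∈ s, y ∈ Metric.closedBall z (r / 2 ^ 2) := by
    intro y hy
    obtain ⟨z, hz, hxz⟩ := Set.mem_iUnion₂.1 (hc (hT hy))
    exact ⟨z, hz, hxz⟩
  choose! f hf hf2 using this
  have h1 : T.encard ≤ (s : Set Y).encard := by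
    apply Set.encard_le_encard_of_injOn (f := f) (fun y hy => hf y hy)
    intro a ha b hb hab
    by_contra hne
    have h := hsep ha hb hne
    have h3 := hf2 a ha
    have h4 := hf2 b hb
    rw [hab] at h3
    rw [Metric.mem_closedBall] at h3 h4
    have := dist_triangle_right a b (f b)
    linarith
  refine h1.trans ?_
  rw [Set.encard_coe_eq_coe_finsetCard]
  exact_mod_cast hs

theorem aux_maxsep {Y : Type*} [MetricSpace Y] {r : ℝ} (hr : 0 < r) (E : Set Y) :
    ∃ S ⊆ E, (S.Pairwise fun a b => r < dist a b) ∧ E ⊆ ⋃ s ∈ S, Metric.closedBall s r := by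
  obtain ⟨S, hS⟩ := zorn_subset {S : Set Y | S ⊆ E ∧ S.Pairwise fun a b => r < dist a b} (by
    intro c hc hchain
    refine ⟨⋃₀ c, ⟨Set.sUnion_subset fun s hs => (hc hs).1, ?_⟩,
      fun s hs => Set.subset_sUnion_of_mem hs⟩
    exact (Set.pairwise_sUnion hchain.directedOn).2 fun s hs => (hc hs).2)
  refine ⟨S, hS.prop.1, hS.prop.2, ?_⟩
  intro x hx
  by_contra hcon
  simp only [Set.mem_iUnion, Metric.mem_closedBall, not_exists, not_le] at hcon
  have : insert x S ⊆ S := hS.2 ⟨Set.insert_subset hx hS.prop.1,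
    Set.pairwise_insert.2
      ⟨hS.prop.2, fun b hb _ => ⟨hcon b hb, by rw [dist_comm]; exact hcon b hb⟩⟩⟩ (Set.subset_insert _ _)
  have h := hcon x (this (Set.mem_insert _ _))
  rw [dist_self] at h
  linarith

theorem aux_bad {Y : Type*} [MetricSpace Y] [MeasurableSpace Y] [BorelSpace Y] {N : ℕ}
    (hN : ∀ (y : Y) (r : ℝ), ∃ s : Finset Y,
      s.card ≤ N ∧ Metric.closedBall y r ⊆ ⋃ z ∈ s, Metric.closedBall z (r / 2))
    (μ : Measure Y) [IsProbabilityMeasure μ] (A : Set Y) {r : ℝ} (hr : 0 < r) (θ : ENNReal) :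
    μ {y ∈ A | μ (A ∩ Metric.closedBall y r) < θ * μ (Metric.closedBall y r)}
      ≤ θ * ((N ^ 2 : ℕ) : ENNReal) := by
  classical
  have := aux_secondCountable hN
  set E := {y ∈ A | μ (A ∩ Metric.closedBall y r) < θ * μ (Metric.closedBall y r)} with hE
  obtain ⟨S, hSE, hsep, hcov⟩ := aux_maxsep hr E
  have hScount : S.Countable := by
    obtain ⟨D, hDc, hDd⟩ := TopologicalSpace.exists_countable_dense Y
    have : S ⊆ ⋃ d ∈ D, (S ∩ Metric.closedBall d r) := by
      intro x hx
      obtain ⟨d, hd, hxd⟩ := hDd.exists_dist_lt x hr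
      exact Set.mem_iUnion₂.2 ⟨d, hd, hx, hxd.le⟩
    refine (hDc.biUnion fun d _ => ?_).mono this
    exact (Set.finite_of_encard_le_coe (aux_mult hN hr d _ Set.inter_subset_right
      (hsep.mono Set.inter_subset_left))).countable
  have := hScount.to_subtype
  have h1 : μ E ≤ ∑' s : S, μ (A ∩ Metric.closedBall (s : Y) r) := by
    refine (measure_mono ?_).trans (measure_iUnion_le _)
    intro x hx
    obtain ⟨s, hs, hxs⟩ := Set.mem_iUnion₂.1 (hcov hx)
    exact Set.mem_iUnion.2 ⟨⟨s, hs⟩, hx.1, hxs⟩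
  have h2 : ∑' s : S, μ (A ∩ Metric.closedBall (s : Y) r)
      ≤ ∑' s : S, θ * μ (Metric.closedBall (s : Y) r) :=
    ENNReal.tsum_le_tsum fun s => (hSE s.2).2.le
  rw [ENNReal.tsum_mul_left] at h2
  refine h1.trans (h2.trans (mul_le_mul_right ?_ _))
  rw [ENNReal.tsum_eq_iSup_sum]
  refine iSup_le fun t => ?_
  have h3 : ∑ s ∈ t, μ (Metric.closedBall (s : Y) r) =
      ∫⁻ x, ∑ s ∈ t, (Metric.closedBall (s : Y) r).indicator 1 x ∂μ := by
    rw [lintegral_finsetSum]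
    · refine Finset.sum_congr rfl fun s _ => ?_
      rw [lintegral_indicator_one Metric.isClosed_closedBall.measurableSet]
    · intro s _
      exact measurable_one.indicator Metric.isClosed_closedBall.measurableSet
  rw [h3]
  have h4 : ∀ x, ∑ s ∈ t, (Metric.closedBall (s : Y) r).indicator (1 : Y → ENNReal) x
      ≤ ((N ^ 2 : ℕ) : ENNReal) := by
    intro x
    simp only [Set.indicator_apply, Pi.one_apply]
    rw [Finset.sum_boole]
    set u := t.filter fun s : S => x ∈ Metric.closedBall (s : Y) r with hu
    have h5 := aux_mult hN hr x ((u.image Subtype.val : Finset Y) : Set Y) (by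
      intro y hy
      simp only [Finset.coe_image, Set.mem_image, Finset.mem_coe, hu, Finset.mem_filter] at hy
      obtain ⟨s, ⟨_, hs⟩, rfl⟩ := hy
      rw [Metric.mem_closedBall, dist_comm]; exact hs) (hsep.mono (by
      intro y hy
      simp only [Finset.coe_image, Set.mem_image] at hy
      obtain ⟨s, _, rfl⟩ := hy
      exact s.2))
    rw [Set.encard_coe_eq_coe_finsetCard, Finset.card_image_of_injective _ Subtype.val_injective]
      at h5
    exact_mod_cast h5
  calc _ ≤ ∫⁻ _, ((N ^ 2 : ℕ) : ENNReal) ∂μ := lintegral_mono h4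
    _ = _ := by simp

theorem aux_density {Y : Type*} [MetricSpace Y] [MeasurableSpace Y] [BorelSpace Y] {N : ℕ}
    (hN : ∀ (y : Y) (r : ℝ), ∃ s : Finset Y,
      s.card ≤ N ∧ Metric.closedBall y r ⊆ ⋃ z ∈ s, Metric.closedBall z (r / 2))
    (μ : Measure Y) [IsProbabilityMeasure μ] (A : Set Y) (a : ENNReal) (ha : a < 1) :
    ∀ᵐ y ∂μ, ∀ᶠ n : ℕ in atTop, y ∈ A →
      a ^ n * μ (Metric.closedBall y ((1 / 2) ^ n)) ≤ μ (A ∩ Metric.closedBall y ((1 / 2) ^ n)) := by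
  have := ae_eventually_notMem (μ := μ) (s := fun n : ℕ => {y ∈ A |
    μ (A ∩ Metric.closedBall y ((1 / 2) ^ n)) < a ^ n * μ (Metric.closedBall y ((1 / 2) ^ n))}) (by
    refine ne_top_of_le_ne_top ?_ (ENNReal.tsum_le_tsum fun n =>
      aux_bad hN μ A (r := (1 / 2) ^ n) (by positivity) (a ^ n))
    rw [ENNReal.tsum_mul_right, ENNReal.tsum_geometric]
    refine ENNReal.mul_ne_top ?_ (ENNReal.natCast_ne_top _)
    rw [ENNReal.inv_ne_top]
    exact (tsub_pos_of_lt ha).ne')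
  filter_upwards [this] with y hy
  filter_upwards [hy] with n hn hA
  by_contra hcon
  exact hn ⟨hA, not_le.1 hcon⟩

/-- Lower polynomial bound for the measure of balls. -/
theorem aux_lower {Y : Type*} [MetricSpace Y] [MeasurableSpace Y] [BorelSpace Y] {N : ℕ}
    (hN : ∀ (y : Y) (r : ℝ), ∃ s : Finset Y,
      s.card ≤ N ∧ Metric.closedBall y r ⊆ ⋃ z ∈ s, Metric.closedBall z (r / 2))
    (μ : Measure Y) [IsProbabilityMeasure μ] :
    ∃ t : ℕ, ∀ᵐ y ∂μ, ∀ᶠ n : ℕ in atTop,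
      ((2 : ENNReal)⁻¹ ^ t) ^ n ≤ μ (Metric.closedBall y ((1 / 2) ^ n)) := by
  have hNt : 2 * N ≤ 2 ^ (2 * N) := Nat.lt_two_pow_self.le
  refine ⟨2 * N, ?_⟩
  set t := 2 * N with ht
  have : Nonempty Y := μ.nonempty_of_neZero
  obtain ⟨y0⟩ := ‹Nonempty Y›
  have key : ∀ m : ℕ, ∀ᵐ y ∂μ, ∀ᶠ n : ℕ in atTop, y ∉ {y ∈ Metric.closedBall y0 (2 ^ m) |
      μ (Metric.closedBall y ((1 / 2) ^ n)) < ((2 : ENNReal)⁻¹ ^ t) ^ n} := by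
    intro m
    apply ae_eventually_notMem
    have hb : ∀ n : ℕ, μ {y ∈ Metric.closedBall y0 (2 ^ m) |
      μ (Metric.closedBall y ((1 / 2) ^ n)) < ((2 : ENNReal)⁻¹ ^ t) ^ n}
        ≤ (N : ENNReal) ^ (m + 1) * 2⁻¹ ^ n := by
      intro n
      set E := {y ∈ Metric.closedBall y0 (2 ^ m) |
        μ (Metric.closedBall y ((1 / 2) ^ n)) < ((2 : ENNReal)⁻¹ ^ t) ^ n} with hE
      obtain ⟨s, hs, hc⟩ := aux_cover hN (m + 1 + n) y0 (2 ^ m)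
      have h1 : μ E ≤ ∑ z ∈ s, μ (E ∩ Metric.closedBall z (2 ^ m / 2 ^ (m + 1 + n))) := by
        refine (measure_mono ?_).trans (measure_biUnion_finset_le _ _)
        intro x hx
        obtain ⟨z, hz, hxz⟩ := Set.mem_iUnion₂.1 (hc hx.1)
        exact Set.mem_iUnion₂.2 ⟨z, hz, hx, hxz⟩
      have h2 : ∀ z ∈ s, μ (E ∩ Metric.closedBall z (2 ^ m / 2 ^ (m + 1 + n)))
          ≤ ((2 : ENNReal)⁻¹ ^ t) ^ n := by
        intro z _
        rcases Set.eq_empty_or_nonempty (E ∩ Metric.closedBall z (2 ^ m / 2 ^ (m + 1 + n)))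
          with h | ⟨y, hy, hyz⟩
        · rw [h]; simp
        · refine (measure_mono ?_).trans hy.2.le
          rintro x ⟨_, hxz⟩
          rw [Metric.mem_closedBall] at *
          have h3 := dist_triangle_right x y z
          have h4 : (2 : ℝ) ^ m / 2 ^ (m + 1 + n) = (1 / 2) ^ n / 2 := by
            rw [pow_add, pow_add, one_div, inv_pow]; field_simp
          rw [h4] at hxz hyz
          linarith
      refine h1.trans ((Finset.sum_le_sum h2).trans ?_)
      rw [Finset.sum_const, nsmul_eq_mul]
      calc (s.card : ENNReal) * ((2 : ENNReal)⁻¹ ^ t) ^ n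
          ≤ (N : ENNReal) ^ (m + 1 + n) * ((2 : ENNReal)⁻¹ ^ t) ^ n := by
            gcongr; exact_mod_cast hs
        _ = (N : ENNReal) ^ (m + 1) * ((N : ENNReal) * (2 : ENNReal)⁻¹ ^ t) ^ n := by
            rw [pow_add, mul_pow, mul_assoc]
        _ ≤ _ := by
            gcongr
            rw [ENNReal.inv_pow.symm, ← div_eq_mul_inv, ENNReal.div_le_iff (by simp) (by simp)]
            have h5 : (2 : ENNReal) * N ≤ 2 ^ t := by exact_mod_cast hNt
            calc (N : ENNReal) = 2⁻¹ * (2 * N) := by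
                  rw [← mul_assoc, ENNReal.inv_mul_cancel (by simp) (by simp), one_mul]
              _ ≤ _ := by gcongr
    refine ne_top_of_le_ne_top ?_ (ENNReal.tsum_le_tsum hb)
    rw [ENNReal.tsum_mul_left, ENNReal.tsum_geometric]
    refine ENNReal.mul_ne_top (by simp) ?_
    rw [ENNReal.inv_ne_top]
    exact (tsub_pos_of_lt (by simp)).ne'
  filter_upwards [ae_all_iff.2 key] with y hy
  obtain ⟨m, hm⟩ := pow_unbounded_of_one_lt (dist y y0) (one_lt_two (α := ℝ))
  filter_upwards [hy m] with n hn
  by_contra hcon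
  exact hn ⟨hm.le, not_le.1 hcon⟩

theorem aux_core {Y Z : Type*} [MetricSpace Y] [MeasurableSpace Y] [BorelSpace Y]
    [MetricSpace Z] [MeasurableSpace Z] [BorelSpace Z]
    (π : Y → Z) (K : NNReal) (hπ : LipschitzWith K π) (μ : Measure Y) (μz : Z → Measure Y)
    (hfiber : ∀ᵐ z ∂(μ.map π), μz z ((π ⁻¹' {z})ᶜ) = 0)
    (hdis : ∀ s : Set Y, MeasurableSet s → μ s = ∫⁻ z, μz z s ∂(μ.map π))
    (A : Set Y) (hA : MeasurableSet A) (b c : ENNReal) (r R : ℝ) (h2 : 2 * r ≤ R)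
    (hK : K * r ≤ R)
    (hb : ∀ y ∈ A, μz (π y) (Metric.closedBall y R) ≤ b) (y : Y)
    (hc : (μ.map π) (Metric.closedBall (π y) R) ≤ c) :
    μ (A ∩ Metric.closedBall y r) ≤ b * c := by
  rw [hdis _ (hA.inter Metric.isClosed_closedBall.measurableSet)]
  calc _ ≤ ∫⁻ z, (Metric.closedBall (π y) R).indicator (fun _ => b) z ∂(μ.map π) := by
        refine lintegral_mono_ae ?_
        filter_upwards [hfiber] with z hz
        rcases Set.eq_empty_or_nonempty ((A ∩ Metric.closedBall y r) ∩ π ⁻¹' {z})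
          with h | ⟨x, ⟨hxA, hxy⟩, hxz⟩
        · have : μz z (A ∩ Metric.closedBall y r) = 0 := measure_mono_null (by
            intro x hx hxz
            have : x ∈ ((A ∩ Metric.closedBall y r) ∩ π ⁻¹' {z}) := ⟨hx, hxz⟩
            rw [h] at this; exact this) hz
          rw [this]; exact zero_le
        · have hxz : π x = z := hxz
          have hzb : z ∈ Metric.closedBall (π y) R := by
            rw [← hxz, Metric.mem_closedBall]
            refine (hπ.dist_le_mul x y).trans (le_trans ?_ hK)
            gcongr
            exact hxy
          rw [Set.indicator_of_mem hzb]
          refine le_trans (measure_mono ?_) (hxz ▸ hb x hxA)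
          rintro w ⟨_, hw⟩
          rw [Metric.mem_closedBall] at *
          have := dist_triangle_right w x y
          linarith
    _ = b * (μ.map π) (Metric.closedBall (π y) R) :=
        lintegral_indicator_const Metric.isClosed_closedBall.measurableSet _
    _ ≤ _ := by gcongr

theorem aux_liminf {W : Type*} [MetricSpace W] [MeasurableSpace W] (m : Measure W)
    [IsProbabilityMeasure m] (w : W) (p : ℝ) (hp : p < lowerPointwiseDim m w) :
    ∀ᶠ ρ : ℝ in 𝓝[>] 0, m (Metric.closedBall w ρ) ≤ ENNReal.ofReal (ρ ^ p) := by
  have h01 : ∀ᶠ ρ : ℝ in 𝓝[>] 0, ρ ∈ Set.Ioo (0 : ℝ) 1 := Ioo_mem_nhdsGT one_pos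
  have hle : ∀ s : Set W, (m s).toReal ≤ 1 := fun s => by
    have := ENNReal.toReal_mono ENNReal.one_ne_top (prob_le_one (μ := m) (s := s))
    simpa using this
  have hb : (𝓝[>] (0 : ℝ)).IsBoundedUnder (· ≥ ·)
      (fun ρ : ℝ => Real.log (m (Metric.closedBall w ρ)).toReal / Real.log ρ) := by
    refine ⟨0, ?_⟩
    rw [eventually_map]
    filter_upwards [h01] with ρ hρ
    exact div_nonneg_of_nonpos (Real.log_nonpos ENNReal.toReal_nonneg (hle _))
      (Real.log_nonpos hρ.1.le hρ.2.le)
  filter_upwards [h01, eventually_lt_of_lt_liminf hp hb] with ρ hρ h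
  have hl : Real.log ρ < 0 := Real.log_neg hρ.1 hρ.2
  rw [lt_div_iff_of_neg hl] at h
  rw [← ENNReal.ofReal_toReal (measure_ne_top m (Metric.closedBall w ρ))]
  apply ENNReal.ofReal_le_ofReal
  rcases (ENNReal.toReal_nonneg (a := m (Metric.closedBall w ρ))).eq_or_lt with h0 | h0
  · rw [← h0]; exact Real.rpow_nonneg hρ.1.le _
  · rw [← Real.log_le_log_iff h0 (Real.rpow_pos_of_pos hρ.1 _), Real.log_rpow hρ.1]
    exact h.le

theorem aux_bdd {W : Type*} [MetricSpace W] [MeasurableSpace W] (m : Measure W)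
    [IsProbabilityMeasure m] (w : W) (t : ℕ)
    (h : ∀ᶠ n : ℕ in atTop, ((2 : ENNReal)⁻¹ ^ t) ^ n ≤ m (Metric.closedBall w ((1 / 2) ^ n))) :
    (𝓝[>] (0 : ℝ)).IsBoundedUnder (· ≤ ·)
      (fun ρ : ℝ => Real.log (m (Metric.closedBall w ρ)).toReal / Real.log ρ) := by
  obtain ⟨M, hM⟩ := eventually_atTop.1 h
  refine ⟨2 * t, ?_⟩
  rw [eventually_map]
  have h01 : ∀ᶠ ρ : ℝ in 𝓝[>] 0, ρ ∈ Set.Ioo (0 : ℝ) ((1 / 2) ^ (M + 1)) :=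
    Ioo_mem_nhdsGT (by positivity)
  filter_upwards [h01] with ρ hρ
  have hρ1 : ρ < 1 := hρ.2.trans_le (pow_le_one₀ (by norm_num) (by norm_num))
  obtain ⟨n, hn1, hn2⟩ := exists_nat_pow_near_of_lt_one hρ.1 hρ1.le
    (by norm_num : (0 : ℝ) < 1 / 2) (by norm_num)
  have hMn : M + 1 < n + 1 :=
    (pow_lt_pow_iff_right_of_lt_one₀ (by norm_num : (0 : ℝ) < 1 / 2) (by norm_num)).1
      (hn1.trans hρ.2)
  have hlow : ((2 : ENNReal)⁻¹ ^ t) ^ (n + 1) ≤ m (Metric.closedBall w ρ) :=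
    (hM (n + 1) (by omega)).trans (measure_mono (Metric.closedBall_subset_closedBall hn1.le))
  have hlow' : (((2 : ℝ)⁻¹) ^ t) ^ (n + 1) ≤ (m (Metric.closedBall w ρ)).toReal := by
    have := ENNReal.toReal_mono (measure_ne_top _ _) hlow
    simpa using this
  have hL : 0 < Real.log 2 := Real.log_pos one_lt_two
  have h1 := Real.log_le_log (by positivity) hlow'
  rw [Real.log_pow, Real.log_pow, Real.log_inv] at h1
  have h2 := Real.log_le_log hρ.1 hn2
  rw [Real.log_pow, one_div, Real.log_inv] at h2
  rw [div_le_iff_of_neg (Real.log_neg hρ.1 hρ1)]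
  refine le_trans ?_ h1
  have hn : (1 : ℝ) ≤ n := by exact_mod_cast (by omega : 1 ≤ n)
  have ht : (0 : ℝ) ≤ t := t.cast_nonneg
  calc 2 * (t : ℝ) * Real.log ρ ≤ 2 * t * (n * -Real.log 2) := by gcongr
    _ ≤ _ := by
      push_cast
      have : 0 ≤ (n - 1) * (t * Real.log 2) := mul_nonneg (by linarith) (by positivity)
      nlinarith

theorem aux_limsup {W : Type*} [MetricSpace W] [MeasurableSpace W] (m : Measure W)
    [IsProbabilityMeasure m] (w : W) (t j : ℕ) (e ε : ℝ) (hε : 0 < ε)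
    (h : ∀ᶠ n : ℕ in atTop, ((2 : ENNReal)⁻¹ ^ t) ^ n ≤ m (Metric.closedBall w ((1 / 2) ^ n)))
    (hu : ∀ᶠ n : ℕ in atTop, (ENNReal.ofReal ((1 / 2) ^ ε)) ^ (n + j) *
      m (Metric.closedBall w ((1 / 2) ^ (n + j))) ≤ ENNReal.ofReal (((1 / 2) ^ n) ^ e)) :
    e - 2 * ε ≤ upperPointwiseDim m w := by
  refine le_limsup_of_frequently_le ?_ (aux_bdd m w t h)
  have hlim : Tendsto (fun n : ℕ => ((1 : ℝ) / 2) ^ (n + j)) atTop (𝓝[>] 0) := by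
    rw [tendsto_nhdsWithin_iff]
    refine ⟨?_, Eventually.of_forall fun n => by simp⟩
    exact (tendsto_add_atTop_iff_nat j).2
      (tendsto_pow_atTop_nhds_zero_of_lt_one (by norm_num) (by norm_num))
  refine hlim.frequently (Eventually.frequently ?_)
  have hbig : ∀ᶠ n : ℕ in atTop, (e - ε) * j / ε ≤ (n : ℝ) :=
    tendsto_natCast_atTop_atTop.eventually_ge_atTop _
  filter_upwards [(tendsto_add_atTop_nat j).eventually h, hu, hbig, eventually_ge_atTop 1]
    with n h1 h2 h3 h4
  have hpos : 0 < (m (Metric.closedBall w ((1 / 2) ^ (n + j)))).toReal := by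
    refine ENNReal.toReal_pos (fun h0 => ?_) (measure_ne_top _ _)
    rw [h0] at h1
    simp at h1
  have h5 := ENNReal.toReal_mono ENNReal.ofReal_ne_top h2
  rw [ENNReal.toReal_mul, ENNReal.toReal_pow, ENNReal.toReal_ofReal (by positivity),
    ENNReal.toReal_ofReal (by positivity)] at h5
  have h6 := Real.log_le_log (by positivity) h5
  rw [Real.log_mul (by positivity) hpos.ne', Real.log_pow, Real.log_rpow (by norm_num),
    Real.log_rpow (by positivity), Real.log_pow, one_div, Real.log_inv] at h6
  have hL : 0 < Real.log 2 := Real.log_pos one_lt_two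
  rw [Real.log_pow, one_div, Real.log_inv]
  have hnj : (0 : ℝ) < ((n + j : ℕ) : ℝ) := by exact_mod_cast (by omega : 0 < n + j)
  rw [le_div_iff_of_neg (by nlinarith)]
  rw [div_le_iff₀ hε] at h3
  push_cast at *
  have := mul_le_mul_of_nonneg_right h3 hL.le
  nlinarith

theorem aux_main
    {Y Z : Type*}
    [MetricSpace Y] [MeasurableSpace Y] [BorelSpace Y]
    [MetricSpace Z] [TopologicalSpace.SeparableSpace Z]
    [MeasurableSpace Z] [BorelSpace Z] {N : ℕ}
    (hN : ∀ (y : Y) (r : ℝ), ∃ s : Finset Y,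
      s.card ≤ N ∧ Metric.closedBall y r ⊆ ⋃ z ∈ s, Metric.closedBall z (r / 2))
    (π : Y → Z) (K : NNReal) (hπ : LipschitzWith K π)
    (μ : Measure Y) [IsProbabilityMeasure μ]
    (μz : Z → Measure Y)
    (hfam : ∀ s : Set Y, MeasurableSet s → Measurable fun z => μz z s)
    (hprob : ∀ z, IsProbabilityMeasure (μz z))
    (hfiber : ∀ᵐ z ∂(μ.map π), μz z ((π ⁻¹' {z})ᶜ) = 0)
    (hdis : ∀ s : Set Y, MeasurableSet s → μ s = ∫⁻ z, μz z s ∂(μ.map π))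
    (p q ε : ℝ) (hε : 0 < ε)
    (hi : ∀ᵐ y ∂μ, p < lowerPointwiseDim (μz (π y)) y) :
    ∀ᵐ y ∂μ, q < lowerPointwiseDim (μ.map π) (π y) →
      p + q - 2 * ε ≤ upperPointwiseDim μ y := by
  have := aux_secondCountable hN
  have : SecondCountableTopology Z := UniformSpace.secondCountable_of_separable Z
  have hπm : Measurable π := hπ.continuous.measurable
  have : IsProbabilityMeasure (μ.map π) := Measure.isProbabilityMeasure_map hπm.aemeasurable
  obtain ⟨t, hlow⟩ := aux_lower hN μ
  let κ : ProbabilityTheory.Kernel Z Y := ⟨μz, Measure.measurable_of_measurable_coe _ hfam⟩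
  have : ProbabilityTheory.IsMarkovKernel κ := ⟨hprob⟩
  have hm1 : ∀ r : ℝ, Measurable fun y => μz (π y) (Metric.closedBall y r) := by
    intro r
    have hs : MeasurableSet {x : Y × Y | dist x.2 x.1 ≤ r} :=
      measurableSet_le (measurable_snd.dist measurable_fst) measurable_const
    exact ProbabilityTheory.Kernel.measurable_kernel_prodMk_left (κ := κ.comap π hπm) hs
  have hm2 : ∀ r : ℝ, Measurable fun y => (μ.map π) (Metric.closedBall (π y) r) := by
    intro r
    have hs : MeasurableSet {x : Z × Z | dist x.2 x.1 ≤ r} :=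
      measurableSet_le (measurable_snd.dist measurable_fst) measurable_const
    exact (measurable_measure_prodMk_left (ν := μ.map π) hs).comp hπm
  let A : ℕ → Set Y := fun k => {y | ∀ n, k ≤ n →
    μz (π y) (Metric.closedBall y ((1 / 2) ^ n)) ≤ ENNReal.ofReal (((1 / 2) ^ n) ^ p) ∧
    (μ.map π) (Metric.closedBall (π y) ((1 / 2) ^ n)) ≤ ENNReal.ofReal (((1 / 2) ^ n) ^ q)}
  have hAm : ∀ k, MeasurableSet (A k) := by
    intro k
    have : A k = ⋂ n, ⋂ (_ : k ≤ n), ({y | μz (π y) (Metric.closedBall y ((1 / 2) ^ n)) ≤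
        ENNReal.ofReal (((1 / 2) ^ n) ^ p)} ∩ {y | (μ.map π) (Metric.closedBall (π y) ((1 / 2) ^ n))
          ≤ ENNReal.ofReal (((1 / 2) ^ n) ^ q)}) := by
      ext y; simp [A]
    rw [this]
    exact MeasurableSet.iInter fun n => MeasurableSet.iInter fun _ =>
      (measurableSet_le (hm1 _) measurable_const).inter
        (measurableSet_le (hm2 _) measurable_const)
  have ha : ENNReal.ofReal ((1 / 2) ^ ε) < 1 := by
    rw [ENNReal.ofReal_lt_one]
    exact Real.rpow_lt_one (by norm_num) (by norm_num) hε
  obtain ⟨j, hj⟩ := pow_unbounded_of_one_lt ((K : ℝ) + 2) (one_lt_two (α := ℝ))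
  have hlim : Tendsto (fun n : ℕ => ((1 : ℝ) / 2) ^ n) atTop (𝓝[>] 0) := by
    rw [tendsto_nhdsWithin_iff]
    exact ⟨tendsto_pow_atTop_nhds_zero_of_lt_one (by norm_num) (by norm_num),
      Eventually.of_forall fun n => by simp⟩
  filter_upwards [hlow, hi, ae_all_iff.2 fun k => aux_density hN μ (A k) _ ha]
    with y hy1 hy2 hy3 hy4
  have hp1 := hprob (π y)
  obtain ⟨k, hk⟩ := eventually_atTop.1 ((hlim.eventually (aux_liminf _ _ _ hy2)).and
    (hlim.eventually (aux_liminf _ _ _ hy4)))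
  have hyA : y ∈ A k := fun n hn => hk n hn
  refine aux_limsup μ y t j (p + q) ε hε hy1 ?_
  filter_upwards [(tendsto_add_atTop_nat j).eventually (hy3 k), eventually_ge_atTop k] with n h1 h2
  refine (h1 hyA).trans ?_
  have hR : (2 : ℝ) ^ j * (1 / 2) ^ (n + j) = (1 / 2) ^ n := by
    rw [pow_add, mul_comm, mul_assoc, ← mul_pow]; norm_num
  have hr : (0 : ℝ) < (1 / 2) ^ (n + j) := by positivity
  have hK0 : (0 : ℝ) ≤ K := K.2
  have := aux_core π K hπ μ μz hfiber hdis (A k) (hAm k) (ENNReal.ofReal (((1 / 2) ^ n) ^ p))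
    (ENNReal.ofReal (((1 / 2) ^ n) ^ q)) ((1 / 2) ^ (n + j)) ((1 / 2) ^ n)
    (by rw [← hR]; gcongr; linarith) (by rw [← hR]; gcongr; linarith)
    (fun y' hy' => (hy' n h2).1) y (hyA n h2).2
  rw [← ENNReal.ofReal_mul (by positivity), ← Real.rpow_add (by positivity)] at this
  exact this

/-- Let `Y` be a complete doubling metric space, `Z` a complete
separable metric space, `π : Y → Z` Lipschitz, `μ` a Borel probability measure on `Y`,
`ν = π_*μ` and `(μz z)` a disintegration of `μ` over `ν` along `π`.  If for `μ`-a.e.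
`y` the lower pointwise dimension of `μz (π y)` at `y` is `≥ γ` and the lower pointwise
dimension of `ν` at `π y` is `≥ δ (π y)`, then for `μ`-a.e. `y` the upper pointwise
dimension of `μ` at `y` is `≥ γ + δ (π y)`. -/
theorem upperDim_superadditive_doubling
    {Y Z : Type*}
    [MetricSpace Y] [CompleteSpace Y]
    [MeasurableSpace Y] [BorelSpace Y]
    [MetricSpace Z] [CompleteSpace Z] [TopologicalSpace.SeparableSpace Z]
    [MeasurableSpace Z] [BorelSpace Z]
    (hdoub : ∃ N : ℕ, ∀ (y : Y) (r : ℝ), ∃ s : Finset Y,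
      s.card ≤ N ∧ Metric.closedBall y r ⊆ ⋃ z ∈ s, Metric.closedBall z (r / 2))
    (π : Y → Z) (K : NNReal) (hπ : LipschitzWith K π)
    (μ : Measure Y) [IsProbabilityMeasure μ]
    (μz : Z → Measure Y)
    (hfam : ∀ s : Set Y, MeasurableSet s → Measurable fun z => μz z s)
    (hprob : ∀ z, IsProbabilityMeasure (μz z))
    (hfiber : ∀ᵐ z ∂(μ.map π), μz z ((π ⁻¹' {z})ᶜ) = 0)
    (hdis : ∀ s : Set Y, MeasurableSet s → μ s = ∫⁻ z, μz z s ∂(μ.map π))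
    (γ : ℝ) (hγ : 0 ≤ γ)
    (δ : Z → ℝ) (hδm : Measurable δ) (hδ0 : ∀ z, 0 ≤ δ z)
    (hi : ∀ᵐ y ∂μ, γ ≤ lowerPointwiseDim (μz (π y)) y)
    (hii : ∀ᵐ y ∂μ, δ (π y) ≤ lowerPointwiseDim (μ.map π) (π y)) :
    ∀ᵐ y ∂μ, γ + δ (π y) ≤ upperPointwiseDim μ y := by
  obtain ⟨N, hN⟩ := hdoub
  have key : ∀ (q : ℚ) (i : ℕ), ∀ᵐ y ∂μ, (q : ℝ) < lowerPointwiseDim (μ.map π) (π y) →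
      (γ - 1 / ((i : ℝ) + 1)) + q - 2 * (1 / ((i : ℝ) + 1)) ≤ upperPointwiseDim μ y := by
    intro q i
    have hpos : 0 < 1 / ((i : ℝ) + 1) := by positivity
    refine aux_main hN π K hπ μ μz hfam hprob hfiber hdis _ q _ hpos ?_
    filter_upwards [hi] with y hy
    linarith
  filter_upwards [ae_all_iff.2 fun q => ae_all_iff.2 fun i => key q i, hii] with y hy hy2
  refine le_of_forall_pos_le_add fun s hs => ?_
  obtain ⟨i, hi'⟩ := exists_nat_one_div_lt (show 0 < s / 6 by positivity)
  obtain ⟨q, hq1, hq2⟩ := exists_rat_btwn (show δ (π y) - s / 2 < δ (π y) by linarith)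
  have := hy q i (hq2.trans_le hy2)
  linarith
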